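/- Double-rotation inequality for optimal alphabetic trees: let T be an optimal alphabetic tree. If f is an internal node with left child e and right child g, where e is internal with right child c and c itself is internal, then w(c) ≤ w(g). Symmetrically, if f has right child e' and left child g', where e' is internal with left child c' and c' is internal, then w(c') ≤ w(g'). -/

import Mathlib

/-- Binary trees in which every internal node has exactly two children and
every leaf carries a nonnegative real weight. -/
inductive WTree : Type
  | leaf : ℝ → WTree
  | node : WTree → WTree → WTree

namespace WTree

/-- The weights of the leaves in left-to-right order. -/
def leaves : WTree → List ℝ
  | leaf x => [x]
  | node l r => leaves l ++ leaves r

/-- The total weight of the leaves of a tree. -/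
def wt (t : WTree) : ℝ := t.leaves.sum

/-- The cost `Σ aᵢ dᵢ` of an alphabetic tree (each leaf weight times its
depth), computed recursively. -/
def cost : WTree → ℝ
  | leaf _ => 0
  | node l r => cost l + cost r + wt l + wt r

/-- `t` is an optimal alphabetic tree: it minimizes cost among all alphabetic
trees on the same left-to-right sequence of leaf weights. -/
def IsOAT (t : WTree) : Prop :=
  ∀ t' : WTree, t'.leaves = t.leaves → cost t ≤ cost t'

/-- `IsSubtree s t`: `s` occurs as (the subtree rooted at) a node of `t`. -/
inductive IsSubtree : WTree → WTree → Prop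
  | refl (t : WTree) : IsSubtree t t
  | left {s l r : WTree} : IsSubtree s l → IsSubtree s (node l r)
  | right {s l r : WTree} : IsSubtree s r → IsSubtree s (node l r)

end WTree

namespace WTree

theorem wt_node (l r : WTree) : (node l r).wt = l.wt + r.wt := by
  simp [wt, leaves]

theorem wt_eq_of_leaves_eq {s t : WTree} (h : s.leaves = t.leaves) : s.wt = t.wt := by
  simp [wt, h]

/-- Every subtree of an optimal alphabetic tree is optimal. -/
theorem IsOAT.of_isSubtree {s t : WTree} (hs : IsSubtree s t) (ht : t.IsOAT) : s.IsOAT := by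
  induction hs with
  | refl => exact ht
  | @left l r _ ih =>
    refine ih fun l' hl' => ?_
    have h := ht (node l' r) (by simp [leaves, hl'])
    simp only [cost, wt_eq_of_leaves_eq hl'] at h
    linarith
  | @right l r _ ih =>
    refine ih fun r' hr' => ?_
    have h := ht (node l r') (by simp [leaves, hr'])
    simp only [cost, wt_eq_of_leaves_eq hr'] at h
    linarith

end WTree

/-- **Double-rotation inequality for optimal alphabetic trees.**
In an optimal alphabetic tree `T` (with nonnegative weights):
if an internal node `f` has left child `e = node d c` and right child `g`,
where `c = node x y` is internal, then `w(c) ≤ w(g)`; symmetrically, if `f`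
has left child `g'` and right child `e' = node c' d''` with `c' = node x' y'`
internal, then `w(c') ≤ w(g')`. -/
theorem oat_double_rotation_inequality (T : WTree)
    (hnn : ∀ x ∈ T.leaves, (0 : ℝ) ≤ x) (hopt : T.IsOAT) :
    (∀ d x y g : WTree,
      WTree.IsSubtree (WTree.node (WTree.node d (WTree.node x y)) g) T →
        (WTree.node x y).wt ≤ g.wt) ∧
    (∀ g' x' y' d'' : WTree,
      WTree.IsSubtree (WTree.node g' (WTree.node (WTree.node x' y') d'')) T →
        (WTree.node x' y').wt ≤ g'.wt) := by
  refine ⟨fun d x y g hs => ?_, fun g x y d hs => ?_⟩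
  · have h := WTree.IsOAT.of_isSubtree hs hopt (.node (.node d x) (.node y g)) (by simp [WTree.leaves])
    simp only [WTree.cost, WTree.wt_node] at h ⊢
    linarith
  · have h := WTree.IsOAT.of_isSubtree hs hopt (.node (.node g x) (.node y d)) (by simp [WTree.leaves])
    simp only [WTree.cost, WTree.wt_node] at h ⊢
    linarith
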